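/- Let q be an odd prime power, let G = PGL₂(𝔽_q), and let ε = 1 if q ≡ 1 (mod 4) and ε = −1 if q ≡ 3 (mod 4), so that 4 divides q − ε. Suppose: i ∈ G is an involution and T_i ≤ C_G(i) is a cyclic subgroup of cardinality q − ε; j ∈ G is an involution satisfying j⁻¹·t·j = t⁻¹ for all t ∈ T_i; T_j ≤ C_G(j) is a cyclic subgroup of cardinality q − ε; t_i ∈ T_i has order 4 and t_j ∈ T_j has order 4. Then the subgroup of G generated by {t_i, t_j} is isomorphic to the symmetric group on 4 letters. -/

import Mathlib

open Matrix

/-- `PGL₂(F)`: the quotient of `GL₂(F)` by its center. -/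
abbrev PGL2 (F : Type*) [Field F] : Type _ :=
  GL (Fin 2) F ⧸ Subgroup.center (GL (Fin 2) F)

open Quaternion

instance : DecidableEq ℍ[ℤ,-1,0,-1] := fun a b =>
  decidable_of_iff (a.re = b.re ∧ a.imI = b.imI ∧ a.imJ = b.imJ ∧ a.imK = b.imK)
    (QuaternionAlgebra.ext_iff).symm

/-- An integral quaternion inducing the rotation of a cube which permutes its four diagonals
`(1, 1, 1)`, `(1, -1, -1)`, `(-1, 1, -1)`, `(-1, -1, 1)` according to `σ`. -/
def cubeQuaternion (σ : Equiv.Perm (Fin 4)) : ℍ[ℤ,-1,0,-1] :=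
  match (σ 0).val, (σ 1).val, (σ 2).val with
  | 0, 1, 2 => ⟨1, 0, 0, 0⟩
  | 0, 1, 3 => ⟨0, 0, 1, -1⟩
  | 0, 2, 1 => ⟨0, 1, -1, 0⟩
  | 0, 2, 3 => ⟨1, 1, 1, 1⟩
  | 0, 3, 1 => ⟨1, -1, -1, -1⟩
  | 0, 3, 2 => ⟨0, 1, 0, -1⟩
  | 1, 0, 2 => ⟨0, 0, 1, 1⟩
  | 1, 0, 3 => ⟨0, 1, 0, 0⟩
  | 1, 2, 0 => ⟨1, 1, 1, -1⟩
  | 1, 2, 3 => ⟨1, 0, -1, 0⟩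
  | 1, 3, 0 => ⟨1, 0, 0, 1⟩
  | 1, 3, 2 => ⟨1, -1, 1, -1⟩
  | 2, 0, 1 => ⟨1, -1, -1, 1⟩
  | 2, 0, 3 => ⟨1, 0, 0, -1⟩
  | 2, 1, 0 => ⟨0, 1, 0, 1⟩
  | 2, 1, 3 => ⟨1, -1, 1, 1⟩
  | 2, 3, 0 => ⟨0, 0, 1, 0⟩
  | 2, 3, 1 => ⟨1, 1, 0, 0⟩
  | 3, 0, 1 => ⟨1, 0, 1, 0⟩
  | 3, 0, 2 => ⟨1, 1, -1, 1⟩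
  | 3, 1, 0 => ⟨1, 1, -1, -1⟩
  | 3, 1, 2 => ⟨0, 1, 1, 0⟩
  | 3, 2, 0 => ⟨1, -1, 0, 0⟩
  | _, _, _ => ⟨0, 0, 0, 1⟩

/-- The quarter turn of the cube about the first axis, as a permutation of the diagonals. -/
def quarterTurnI : Equiv.Perm (Fin 4) := c[0, 2, 1, 3]

/-- The quarter turn of the cube about the second axis, as a permutation of the diagonals. -/
def quarterTurnJ : Equiv.Perm (Fin 4) := c[0, 3, 2, 1]

theorem cubeQuaternion_quarterTurnI : cubeQuaternion quarterTurnI = ⟨1, 1, 0, 0⟩ := by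
  decide +kernel

theorem cubeQuaternion_quarterTurnJ : cubeQuaternion quarterTurnJ = ⟨1, 0, 1, 0⟩ := by
  decide +kernel

theorem star_mul_cubeQuaternion (σ : Equiv.Perm (Fin 4)) :
    ∃ n ∈ ([1, 2, 4] : List ℤ), star (cubeQuaternion σ) * cubeQuaternion σ = n • 1 := by
  revert σ
  decide +kernel

theorem cubeQuaternion_mul (σ τ : Equiv.Perm (Fin 4)) :
    ∃ n ∈ ([1, -1, 2, -2, 4, -4] : List ℤ),
      cubeQuaternion σ * cubeQuaternion τ = n • cubeQuaternion (σ * τ) := by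
  revert σ τ
  decide +kernel

theorem exists_star_commutator_mul_cubeQuaternion {σ : Equiv.Perm (Fin 4)} (hσ : σ ≠ 1) :
    ∃ u ∈ ([⟨0, 1, 0, 0⟩, ⟨0, 0, 1, 0⟩] : List ℍ[ℤ,-1,0,-1]), ∃ n ∈ ([4, 8] : List ℤ),
      star (cubeQuaternion σ * u - u * cubeQuaternion σ) *
        (cubeQuaternion σ * u - u * cubeQuaternion σ) = n • 1 := by
  revert σ
  decide +kernel

theorem closure_quarterTurns :
    Subgroup.closure {quarterTurnI, quarterTurnJ} = (⊤ : Subgroup (Equiv.Perm (Fin 4))) := by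
  have euler : ∀ σ : Equiv.Perm (Fin 4), ∃ l m n : Fin 4,
      quarterTurnI ^ l.val * quarterTurnJ ^ m.val * quarterTurnI ^ n.val = σ := by
    decide +kernel
  refine top_unique fun σ _ => ?_
  obtain ⟨l, m, n, rfl⟩ := euler σ
  have hI : quarterTurnI ∈ Subgroup.closure {quarterTurnI, quarterTurnJ} :=
    Subgroup.subset_closure (by simp)
  have hJ : quarterTurnJ ∈ Subgroup.closure {quarterTurnI, quarterTurnJ} :=
    Subgroup.subset_closure (by simp)
  exact mul_mem (mul_mem (pow_mem hI _) (pow_mem hJ _)) (pow_mem hI _)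

section Matrices

variable {F : Type*} [Field F]

theorem PGL2.mk_eq_mk_iff {A B : GL (Fin 2) F} :
    (A : PGL2 F) = (B : PGL2 F) ↔ ∃ c : F, B.val = c • A.val := by
  rw [QuotientGroup.eq, GeneralLinearGroup.mem_center_iff_val_mem_range_scalar]
  constructor
  · rintro ⟨c, hc⟩
    refine ⟨c, ?_⟩
    have h : B.val = A.val * (A⁻¹ * B).val := by
      rw [← Units.val_mul, mul_inv_cancel_left]
    rw [h, ← hc, scalar_apply, ← smul_one_eq_diagonal, mul_smul_comm, mul_one]
  · rintro ⟨c, hc⟩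
    refine ⟨c, ?_⟩
    rw [scalar_apply, ← smul_one_eq_diagonal, Units.val_mul, hc, mul_smul_comm, ← Units.val_mul,
      inv_mul_cancel, Units.val_one]

theorem PGL2.mk_eq_one_iff {A : GL (Fin 2) F} :
    (A : PGL2 F) = 1 ↔ ∃ c : F, A.val = c • (1 : Matrix (Fin 2) (Fin 2) F) := by
  rw [eq_comm, ← QuotientGroup.mk_one, PGL2.mk_eq_mk_iff, Units.val_one]

/-- Cayley-Hamilton for a `2 × 2` matrix. -/
theorem mul_self_fin_two (M : Matrix (Fin 2) (Fin 2) F) :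
    M * M = M.trace • M - M.det • 1 := by
  ext a b
  fin_cases a <;> fin_cases b <;> simp [mul_apply, trace_fin_two, det_fin_two] <;> ring

/-- The polarization of Cayley-Hamilton for `2 × 2` matrices. -/
theorem mul_add_mul_fin_two (M N : Matrix (Fin 2) (Fin 2) F) :
    M * N + N * M =
      M.trace • N + N.trace • M + ((M * N).trace - M.trace * N.trace) • 1 := by
  ext a b
  fin_cases a <;> fin_cases b <;> simp [mul_apply, trace_fin_two] <;> ring

/-- A nonscalar `2 × 2` matrix with scalar square has trace zero. -/
theorem trace_eq_zero_of_mul_self_eq_smul_one {M : Matrix (Fin 2) (Fin 2) F} {c : F}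
    (hM : M * M = c • 1) (hns : ∀ a : F, M ≠ a • 1) : M.trace = 0 := by
  by_contra h
  refine hns (M.trace⁻¹ * (c + M.det)) ?_
  have := mul_self_fin_two M
  rw [mul_smul, add_smul, ← hM, this, sub_add_cancel, inv_smul_smul₀ h]

/-- Elements of order four in `PGL₂(F)` are represented by matrices `1 + X` with `X ^ 2 = -1`. -/
theorem PGL2.exists_eq_mk_of_orderOf_eq_four (h2 : (2 : F) ≠ 0) {a : PGL2 F}
    (ha : orderOf a = 4) :
    ∃ (A : GL (Fin 2) F) (X : Matrix (Fin 2) (Fin 2) F),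
      (A : PGL2 F) = a ∧ A.val = 1 + X ∧ X * X = -1 ∧ X.trace = 0 := by
  obtain ⟨A, rfl⟩ := QuotientGroup.mk_surjective a
  have ha1 : ∀ c : F, A.val ≠ c • 1 := fun c hc => by
    rw [PGL2.mk_eq_one_iff.2 ⟨c, hc⟩, orderOf_one] at ha
    omega
  have ha2 : ∀ c : F, A.val * A.val ≠ c • 1 := fun c hc => by
    have : (A : PGL2 F) ^ 2 = 1 := by
      rw [← QuotientGroup.mk_pow, PGL2.mk_eq_one_iff, sq]
      exact ⟨c, hc⟩
    have := orderOf_dvd_of_pow_eq_one this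
    rw [ha] at this
    omega
  obtain ⟨c, hc⟩ : ∃ c : F, (A.val * A.val) * (A.val * A.val) = c • 1 := by
    have := pow_orderOf_eq_one (A : PGL2 F)
    rw [ha, ← QuotientGroup.mk_pow, PGL2.mk_eq_one_iff] at this
    obtain ⟨c, hc⟩ := this
    exact ⟨c, by rw [← hc, Units.val_pow_eq_pow_val]; noncomm_ring⟩
  have hA := mul_self_fin_two A.val
  have htr2 := trace_eq_zero_of_mul_self_eq_smul_one hc ha2
  set t := A.val.trace
  set d := A.val.det
  have ht : t ≠ 0 := fun h => ha2 (-d) (by rw [hA, h, zero_smul, zero_sub, neg_smul])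
  have htd : t * t = 2 * d := by
    rw [hA] at htr2
    simp only [trace_sub, trace_smul, trace_one, Fintype.card_fin, smul_eq_mul] at htr2
    push_cast at htr2
    change t * t - d * 2 = 0 at htr2
    linear_combination htr2
  have hs : 2 / t ≠ 0 := div_ne_zero h2 ht
  let B : GL (Fin 2) F := (Units.map (algebraMap F (Matrix (Fin 2) (Fin 2) F)).toMonoidHom
    (Units.mk0 _ hs)) * A
  have hB : B.val = (2 / t) • A.val := by
    simp [B, Algebra.algebraMap_eq_smul_one]
  refine ⟨B, (2 / t) • A.val - 1, (PGL2.mk_eq_mk_iff.2 ⟨_, hB⟩).symm, by rw [hB]; abel, ?_, ?_⟩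
  · have : ((2 / t) • A.val - 1) * ((2 / t) • A.val - 1) =
        (2 / t * (2 / t)) • (A.val * A.val) - (2 * (2 / t)) • A.val + 1 := by
      simp only [sub_mul, mul_sub, smul_mul_smul_comm, one_mul, mul_one, two_mul, add_smul]
      abel
    rw [this, hA, smul_sub, smul_smul, smul_smul]
    have e1 : 2 / t * (2 / t) * t = 2 * (2 / t) := by field_simp
    have e2 : 2 / t * (2 / t) * d = 2 := by
      field_simp
      linear_combination -htd
    rw [e1, e2, two_smul]
    abel
  · simp only [trace_sub, trace_smul, trace_one, Fintype.card_fin, smul_eq_mul]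
    change 2 / t * t - _ = 0
    rw [div_mul_cancel₀ _ ht]
    simp

/-- An involution commuting with the class of `1 + Y`, where `Y ^ 2 = -1` and `Y` has trace zero,
is represented by a multiple of `Y`. -/
theorem PGL2.exists_eq_smul_of_commute (h2 : (2 : F) ≠ 0) {B J : GL (Fin 2) F}
    {Y : Matrix (Fin 2) (Fin 2) F} (hB : B.val = 1 + Y) (hY : Y * Y = -1) (hYtr : Y.trace = 0)
    (hJ : orderOf (J : PGL2 F) = 2) (hJB : (J : PGL2 F) * B = B * J) :
    ∃ s : F, J.val = s • Y := by
  have hJ1 : ∀ c : F, J.val ≠ c • 1 := fun c hc => by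
    rw [PGL2.mk_eq_one_iff.2 ⟨c, hc⟩, orderOf_one] at hJ
    omega
  have hJtr : J.val.trace = 0 := by
    have := pow_orderOf_eq_one (J : PGL2 F)
    rw [hJ, ← QuotientGroup.mk_pow, PGL2.mk_eq_one_iff] at this
    obtain ⟨c, hc⟩ := this
    rw [sq] at hc
    exact trace_eq_zero_of_mul_self_eq_smul_one hc hJ1
  have hcomm : J.val * Y = Y * J.val := by
    rw [← QuotientGroup.mk_mul, ← QuotientGroup.mk_mul, PGL2.mk_eq_mk_iff] at hJB
    obtain ⟨c, hc⟩ := hJB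
    have hconj : B.val = c • (J.val * B.val * J⁻¹.val) := by
      rw [← smul_mul_assoc, ← Units.val_mul, ← hc, ← Units.val_mul, mul_inv_cancel_right]
    have htr := congrArg trace hconj
    rw [trace_smul, trace_mul_cycle, ← Units.val_mul, inv_mul_cancel, Units.val_one, one_mul, hB,
      trace_add, hYtr, trace_one, Fintype.card_fin, add_zero, smul_eq_mul] at htr
    have hc1 : c = 1 := mul_right_cancel₀ h2 (by push_cast at htr; rw [← htr, one_mul])
    rw [hc1, one_smul, Units.val_mul, Units.val_mul, hB, add_mul, mul_add, one_mul, mul_one] at hc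
    exact (add_left_cancel hc).symm
  have hpol := mul_add_mul_fin_two J.val Y
  rw [← hcomm, hJtr, hYtr, zero_smul, zero_smul, zero_add, zero_add, mul_zero, sub_zero,
    ← two_smul F] at hpol
  set r := (J.val * Y).trace
  refine ⟨-(2⁻¹ * r), ?_⟩
  have : J.val * Y = (2⁻¹ * r) • 1 := by
    rw [mul_smul, ← hpol, inv_smul_smul₀ h2]
  calc J.val = -(J.val * Y * Y) := by rw [mul_assoc, hY, mul_neg, neg_neg, mul_one]
    _ = _ := by rw [this, smul_mul_assoc, one_mul, neg_smul]

/-- If the class of a multiple of `Y` inverts the class of `1 + X`, then `X` and `Y`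
anticommute. -/
theorem PGL2.anticommute_of_inverts (h2 : (2 : F) ≠ 0) {A J : GL (Fin 2) F} {s : F}
    {X Y : Matrix (Fin 2) (Fin 2) F} (hA : A.val = 1 + X) (hJ : J.val = s • Y)
    (hX : X * X = -1) (hXtr : X.trace = 0) (hYtr : Y.trace = 0)
    (hinv : (A : PGL2 F) * J * A = J) : Y * X = -(X * Y) := by
  rw [← QuotientGroup.mk_mul, ← QuotientGroup.mk_mul, eq_comm, PGL2.mk_eq_mk_iff] at hinv
  obtain ⟨c, hc⟩ := hinv
  have hs : s ≠ 0 := by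
    rintro rfl
    rw [zero_smul] at hJ
    exact J.ne_zero hJ
  rw [Units.val_mul, Units.val_mul, hA, hJ, mul_smul_comm, smul_mul_assoc, smul_comm] at hc
  replace hc := smul_right_injective _ hs hc
  have hpol := mul_add_mul_fin_two X Y
  rw [hXtr, hYtr, zero_smul, zero_smul, zero_add, zero_add, mul_zero, sub_zero] at hpol
  set t := (X * Y).trace
  have hYX : Y * X = t • 1 - X * Y := by rw [← hpol]; abel
  have hexp : (1 + X) * Y * (1 + X) = 2 • Y + t • 1 + t • X := by
    calc (1 + X) * Y * (1 + X) = Y + (X * Y + Y * X) + X * (Y * X) := by noncomm_ring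
      _ = Y + t • 1 + (t • X - X * X * Y) := by
        rw [hpol, hYX, mul_sub, mul_smul_comm, mul_one, mul_assoc]
      _ = _ := by rw [hX]; noncomm_ring
  have htr := congrArg trace (hexp.symm.trans hc)
  simp only [trace_add, trace_smul, hXtr, hYtr, trace_one, smul_zero, zero_add, add_zero,
    Fintype.card_fin, smul_eq_mul, mul_zero] at htr
  have h2' : ((2 : ℕ) : F) ≠ 0 := by exact_mod_cast h2
  have ht : t = 0 := (mul_eq_zero.1 htr).resolve_right h2'
  rw [hYX, ht, zero_smul, zero_sub]

/-- If `X` and `Y` generate a quaternion algebra, then `1 + X` and `1 + Y` generate a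
copy of the rotation group of the cube, which is `Sym₄`. -/
theorem PGL2.nonempty_closure_mulEquiv_perm (h2 : (2 : F) ≠ 0) {A B : GL (Fin 2) F}
    {X Y : Matrix (Fin 2) (Fin 2) F} (hA : A.val = 1 + X) (hB : B.val = 1 + Y)
    (hX : X * X = -1) (hY : Y * Y = -1) (hYX : Y * X = -(X * Y)) :
    Nonempty ((Subgroup.closure {(A : PGL2 F), (B : PGL2 F)} : Subgroup (PGL2 F))
      ≃* Equiv.Perm (Fin 4)) := by
  let basis : QuaternionAlgebra.Basis (Matrix (Fin 2) (Fin 2) F) (-1 : ℤ) 0 (-1) :=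
    { i := X, j := Y, k := X * Y
      i_mul_i := by simp [hX]
      j_mul_j := by simp [hY]
      i_mul_j := rfl
      j_mul_i := by simp [hYX] }
  let φ := basis.liftHom
  have hpow : ∀ n : ℕ, ((2 ^ n : ℤ) : F) ≠ 0 := fun n => by
    push_cast
    exact pow_ne_zero n h2
  have hφ_smul : ∀ (n : ℤ) x, φ (n • x) = (n : F) • φ x := fun n x => by
    rw [map_zsmul, Int.cast_smul_eq_zsmul]
  have hφ_unit : ∀ σ, IsUnit (φ (cubeQuaternion σ)) := fun σ => by
    obtain ⟨n, hn, h⟩ := star_mul_cubeQuaternion σ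
    have hn0 : (n : F) ≠ 0 := by
      simp only [List.mem_cons, List.not_mem_nil, or_false] at hn
      rcases hn with rfl | rfl | rfl
      exacts [hpow 0, hpow 1, hpow 2]
    refine IsUnit.of_mul_eq_one_right ((n : F)⁻¹ • φ (star (cubeQuaternion σ))) ?_
    rw [smul_mul_assoc, ← map_mul, h, hφ_smul, inv_smul_smul₀ hn0, map_one]
  have hφ_mul : ∀ σ τ, (((hφ_unit (σ * τ)).unit : GL (Fin 2) F) : PGL2 F) =
      ((hφ_unit σ).unit : GL (Fin 2) F) * ((hφ_unit τ).unit : GL (Fin 2) F) := fun σ τ => by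
    obtain ⟨n, -, h⟩ := cubeQuaternion_mul σ τ
    rw [← QuotientGroup.mk_mul, PGL2.mk_eq_mk_iff]
    exact ⟨n, by simp only [Units.val_mul, IsUnit.unit_spec, ← map_mul, h, hφ_smul]⟩
  let f : Equiv.Perm (Fin 4) →* PGL2 F :=
    MonoidHom.mk' (fun σ => ((hφ_unit σ).unit : GL (Fin 2) F)) hφ_mul
  have hf_inj : Function.Injective f := by
    rw [injective_iff_map_eq_one]
    intro σ hσ
    by_contra hne
    obtain ⟨c, hc⟩ := PGL2.mk_eq_one_iff.1 hσ
    rw [IsUnit.unit_spec] at hc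
    obtain ⟨u, -, n, hn, h⟩ := exists_star_commutator_mul_cubeQuaternion hne
    have hn0 : (n : F) ≠ 0 := by
      simp only [List.mem_cons, List.not_mem_nil, or_false] at hn
      rcases hn with rfl | rfl
      exacts [hpow 2, hpow 3]
    have := congrArg φ h
    rw [map_mul, map_sub, map_mul, map_mul, hc, smul_mul_assoc, mul_smul_comm, one_mul, mul_one,
      sub_self, mul_zero, hφ_smul, map_one] at this
    exact smul_ne_zero hn0 one_ne_zero this.symm
  have hfI : f quarterTurnI = A := by
    refine congrArg _ (Units.ext ?_)
    rw [IsUnit.unit_spec, cubeQuaternion_quarterTurnI, hA]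
    simp [φ, basis, QuaternionAlgebra.Basis.liftHom, QuaternionAlgebra.Basis.lift]
  have hfJ : f quarterTurnJ = B := by
    refine congrArg _ (Units.ext ?_)
    rw [IsUnit.unit_spec, cubeQuaternion_quarterTurnJ, hB]
    simp [φ, basis, QuaternionAlgebra.Basis.liftHom, QuaternionAlgebra.Basis.lift]
  have hrange : f.range = Subgroup.closure {(A : PGL2 F), (B : PGL2 F)} := by
    rw [MonoidHom.range_eq_map, ← closure_quarterTurns, MonoidHom.map_closure, Set.image_pair,
      hfI, hfJ]
  exact ⟨((MonoidHom.ofInjective hf_inj).trans (MulEquiv.subgroupCongr hrange)).symm⟩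

end Matrices

/-- The alternative construction of `Sym₄` in `G = PGL₂(𝔽_q)`, `q` an odd prime
power: if `i`, `j` are involutions with cyclic tori `T_i ≤ C_G(i)`,
`T_j ≤ C_G(j)` of cardinality `q - ε` (where `4 ∣ q - ε`), `j` inverts `T_i`,
and `t_i ∈ T_i`, `t_j ∈ T_j` have order `4`, then `⟨t_i, t_j⟩ ≅ Sym₄`. -/
theorem sym4_from_two_order_four_elements_PGL2
    (p : ℕ) [Fact p.Prime] (hp : Odd p) (k : ℕ) (hk : 0 < k)
    (q : ℕ) (hq : q = p ^ k)
    (d : ℕ) (hd : (q % 4 = 1 ∧ d = q - 1) ∨ (q % 4 = 3 ∧ d = q + 1))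
    (i : PGL2 (GaloisField p k)) (hi : orderOf i = 2)
    (Ti : Subgroup (PGL2 (GaloisField p k)))
    (hTile : Ti ≤ Subgroup.centralizer {i}) (hTicyc : IsCyclic Ti)
    (hTicard : Nat.card Ti = d)
    (j : PGL2 (GaloisField p k)) (hj : orderOf j = 2)
    (hjinv : ∀ t ∈ Ti, j⁻¹ * t * j = t⁻¹)
    (Tj : Subgroup (PGL2 (GaloisField p k)))
    (hTjle : Tj ≤ Subgroup.centralizer {j}) (hTjcyc : IsCyclic Tj)
    (hTjcard : Nat.card Tj = d)
    (ti : PGL2 (GaloisField p k)) (htiT : ti ∈ Ti) (hti : orderOf ti = 4)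
    (tj : PGL2 (GaloisField p k)) (htjT : tj ∈ Tj) (htj : orderOf tj = 4) :
    Nonempty ((Subgroup.closure {ti, tj} : Subgroup (PGL2 (GaloisField p k)))
      ≃* Equiv.Perm (Fin 4)) := by
  have h2 : (2 : GaloisField p k) ≠ 0 := Ring.two_ne_zero fun h => by
    have hp2 : p = 2 := (ringChar.eq (GaloisField p k) p).symm.trans h
    exact absurd (hp2 ▸ hp) (by decide)
  obtain ⟨A, X, rfl, hA, hX, hXtr⟩ := PGL2.exists_eq_mk_of_orderOf_eq_four h2 hti
  obtain ⟨B, Y, rfl, hB, hY, hYtr⟩ := PGL2.exists_eq_mk_of_orderOf_eq_four h2 htj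
  obtain ⟨J, rfl⟩ := QuotientGroup.mk_surjective j
  obtain ⟨s, hJ⟩ := PGL2.exists_eq_smul_of_commute h2 hB hY hYtr hj
    (Subgroup.mem_centralizer_singleton_iff.1 (hTjle htjT)).symm
  have hinv : (A : PGL2 (GaloisField p k)) * J * A = J := by
    have h := hjinv _ htiT
    rw [mul_assoc, inv_mul_eq_iff_eq_mul] at h
    rw [h, inv_mul_cancel_right]
  exact PGL2.nonempty_closure_mulEquiv_perm h2 hA hB hX hY
    (PGL2.anticommute_of_inverts h2 hA hJ hX hXtr hYtr hinv)
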